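/- Let (G,c) be a colored DAG with vc vertex color classes and ec edge color classes, and let ψ : ℝ_{>0}^{vc} × ℝ^{ec} → Sym_p(ℝ) be the map sending a vector of base parameters (one ω-value per vertex color class and one λ-value per edge color class) to φ_G(Ω,Λ), where Ω and Λ are obtained by assigning every vertex and edge the value of its color class. Then ψ is infinitely differentiable, injective, its total derivative is injective at every point of its domain, and ψ is a homeomorphism onto its image M(G,c) ⊆ PD^V. In particular, M(G,c) is a smooth embedded submanifold of the positive definite cone of dimension vc + ec. -/

import Mathlib

open Matrix

/-- Principal minor `|Σ_A|`: determinant of the submatrix with rows and columns `A`. -/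
noncomputable def pminor {p : ℕ} {R : Type*} [CommRing R] (M : Matrix (Fin p) (Fin p) R)
    (A : Finset (Fin p)) : R :=
  (M.submatrix (fun a : {x // x ∈ A} => a.1) (fun a : {x // x ∈ A} => a.1)).det

/-- Almost-principal minor `|Σ_{ij|K}| = |Σ_{{i}∪K, {j}∪K}|`: determinant of the submatrix
with rows `{i} ∪ K` and columns `{j} ∪ K`, where `i` is matched with `j` and the elements
of `K` are matched with themselves. -/
noncomputable def cminor {p : ℕ} {R : Type*} [CommRing R] (M : Matrix (Fin p) (Fin p) R)
    (i j : Fin p) (K : Finset (Fin p)) : R :=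
  (M.submatrix (Sum.elim (fun _ : Unit => i) (fun k : {x // x ∈ K} => k.1))
               (Sum.elim (fun _ : Unit => j) (fun k : {x // x ∈ K} => k.1))).det

/-- The parametrization `φ_G(Ω,Λ) = (1-Λ)^{-T} Ω (1-Λ)⁻¹` of a Gaussian DAG model. -/
noncomputable def phiG {p : ℕ} (W L : Matrix (Fin p) (Fin p) ℝ) : Matrix (Fin p) (Fin p) ℝ :=
  ((1 - L)⁻¹)ᵀ * W * (1 - L)⁻¹

/-- The parents `pa_G(j) = {k : (k,j) ∈ E}` of a vertex `j` in the DAG with edge set `E`. -/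
def parents {p : ℕ} (E : Finset (Fin p × Fin p)) (j : Fin p) : Finset (Fin p) :=
  Finset.univ.filter (fun k => (k, j) ∈ E)

/-- A directed graph with edge set `E` is acyclic iff no vertex lies on a directed cycle. -/
def IsAcyclic {p : ℕ} (E : Finset (Fin p × Fin p)) : Prop :=
  ∀ i : Fin p, ¬ Relation.TransGen (fun a b => (a, b) ∈ E) i i

/-- `j` lies in `de̅_G(i) = {i} ∪ de_G(i)`, the closure of the descendants of `i`. -/
def InDescClosure {p : ℕ} (E : Finset (Fin p × Fin p)) (i j : Fin p) : Prop :=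
  j = i ∨ Relation.TransGen (fun a b => (a, b) ∈ E) i j

/-- The colored Gaussian DAG model `M(G,c)`. -/
noncomputable def coloredModel {p : ℕ} (E : Finset (Fin p × Fin p))
    (cV : Fin p → ℕ) (cE : Fin p × Fin p → ℕ) : Set (Matrix (Fin p) (Fin p) ℝ) :=
  {S | ∃ (ω : Fin p → ℝ) (L : Matrix (Fin p) (Fin p) ℝ),
    (∀ v, 0 < ω v) ∧ (∀ a b, (a, b) ∉ E → L a b = 0) ∧
    (∀ a b, cV a = cV b → ω a = ω b) ∧
    (∀ e ∈ E, ∀ e' ∈ E, cE e = cE e' → L e.1 e.2 = L e'.1 e'.2) ∧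
    S = phiG (Matrix.diagonal ω) L}

/-- The parametrization of the colored Gaussian DAG model by base parameters:
one `ω`-value per vertex color class (i.e. per element of the image of `cV`) and one
`λ`-value per edge color class (per element of the image of `cE` on `E`); every
vertex/edge is assigned the value of its color class.  The codomain is the space of
`p × p` real matrices viewed as the Pi-type `Fin p → Fin p → ℝ`. -/
noncomputable def psiMap {p : ℕ} (E : Finset (Fin p × Fin p))
    (cV : Fin p → ℕ) (cE : Fin p × Fin p → ℕ)
    (x : ({y // y ∈ Finset.univ.image cV} → ℝ) × ({y // y ∈ E.image cE} → ℝ)) :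
    Fin p → Fin p → ℝ :=
  fun i j =>
    phiG
      (Matrix.diagonal fun v =>
        x.1 ⟨cV v, Finset.mem_image_of_mem cV (Finset.mem_univ v)⟩)
      (Matrix.of fun a b =>
        if h : (a, b) ∈ E then x.2 ⟨cE (a, b), Finset.mem_image_of_mem cE h⟩ else 0)
      i j

namespace Matrix

theorem contDiffAt_det {n F : Type*} [Fintype n] [DecidableEq n] [NormedAddCommGroup F]
    [NormedSpace ℝ F] {k : WithTop ℕ∞} {M : F → Matrix n n ℝ} {x : F}
    (hM : ∀ i j, ContDiffAt ℝ k (fun y => M y i j) x) :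
    ContDiffAt ℝ k (fun y => (M y).det) x := by
  simp only [det_apply']
  exact ContDiffAt.sum fun σ _ => contDiffAt_const.mul (contDiffAt_prod fun i _ => hM _ _)

theorem contDiffAt_inv_apply {n F : Type*} [Fintype n] [DecidableEq n] [NormedAddCommGroup F]
    [NormedSpace ℝ F] {k : WithTop ℕ∞} {M : F → Matrix n n ℝ} {x : F}
    (hM : ∀ i j, ContDiffAt ℝ k (fun y => M y i j) x) (hx : (M x).det ≠ 0) (i j : n) :
    ContDiffAt ℝ k (fun y => (M y)⁻¹ i j) x := by
  simp only [inv_def, Ring.inverse_eq_inv', smul_apply, smul_eq_mul, adjugate_apply]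
  refine ((contDiffAt_det hM).inv hx).mul (contDiffAt_det fun a b => ?_)
  rcases eq_or_ne a j with rfl | h
  · simp only [updateRow_self]
    exact contDiffAt_const
  · simpa only [updateRow_ne h] using hM a b

end Matrix

/-- The number of proper ancestors of a vertex, a topological ordering of an acyclic graph. -/
noncomputable def ancestorCount {p : ℕ} (E : Finset (Fin p × Fin p)) (j : Fin p) : ℕ :=
  {i | Relation.TransGen (fun a b => (a, b) ∈ E) i j}.ncard

theorem IsAcyclic.ancestorCount_lt {p : ℕ} {E : Finset (Fin p × Fin p)} (hE : IsAcyclic E)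
    {i j : Fin p} (hij : (i, j) ∈ E) : ancestorCount E i < ancestorCount E j := by
  refine Set.ncard_lt_ncard ?_ (Set.toFinite _)
  exact ⟨fun _ h => h.tail hij, fun h => hE i (h (Relation.TransGen.single hij))⟩

section Support

variable {p : ℕ} {E : Finset (Fin p × Fin p)} {L : Matrix (Fin p) (Fin p) ℝ}

theorem IsAcyclic.eq_zero_of_le (hE : IsAcyclic E) (hL : ∀ a b, (a, b) ∉ E → L a b = 0)
    {i j : Fin p} (h : ancestorCount E j ≤ ancestorCount E i) : L i j = 0 :=
  hL i j fun hij => (hE.ancestorCount_lt hij).not_ge h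

theorem IsAcyclic.blockTriangular_one_sub (hE : IsAcyclic E)
    (hL : ∀ a b, (a, b) ∉ E → L a b = 0) : (1 - L).BlockTriangular (ancestorCount E) := by
  intro i j h
  have hij : i ≠ j := by rintro rfl; exact h.false
  simp [Matrix.one_apply_ne hij, hE.eq_zero_of_le hL h.le]

theorem IsAcyclic.det_one_sub (hE : IsAcyclic E) (hL : ∀ a b, (a, b) ∉ E → L a b = 0) :
    (1 - L).det = 1 := by
  rw [(hE.blockTriangular_one_sub hL).det]
  refine Finset.prod_eq_one fun k _ => ?_
  suffices h : (1 - L).toSquareBlock (ancestorCount E) k = 1 by rw [h, Matrix.det_one]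
  ext ⟨i, hi⟩ ⟨j, hj⟩
  simp [Matrix.toSquareBlock_def, Matrix.one_apply, Subtype.ext_iff,
    hE.eq_zero_of_le hL (hj.trans hi.symm).le]

theorem IsAcyclic.isUnit_one_sub (hE : IsAcyclic E) (hL : ∀ a b, (a, b) ∉ E → L a b = 0) :
    IsUnit (1 - L).det := by
  simp [hE.det_one_sub hL]

theorem IsAcyclic.inv_one_sub_eq_zero (hE : IsAcyclic E) (hL : ∀ a b, (a, b) ∉ E → L a b = 0)
    {i j : Fin p} (h : ancestorCount E j < ancestorCount E i) : (1 - L)⁻¹ i j = 0 := by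
  have := Matrix.invertibleOfIsUnitDet _ (hE.isUnit_one_sub hL)
  exact Matrix.blockTriangular_inv_of_blockTriangular (hE.blockTriangular_one_sub hL) h

theorem IsAcyclic.inv_one_sub_diag (hE : IsAcyclic E) (hL : ∀ a b, (a, b) ∉ E → L a b = 0)
    (j : Fin p) : (1 - L)⁻¹ j j = 1 := by
  have h := congrFun₂ (Matrix.nonsing_inv_mul _ (hE.isUnit_one_sub hL)) j j
  rw [mul_sub, mul_one, Matrix.sub_apply, Matrix.one_apply_eq, Matrix.mul_apply,
    Finset.sum_eq_zero, sub_zero] at h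
  · exact h
  · intro a _
    rcases lt_or_ge (ancestorCount E a) (ancestorCount E j) with h' | h'
    · rw [hE.inv_one_sub_eq_zero hL h', zero_mul]
    · rw [hE.eq_zero_of_le hL h', mul_zero]

theorem IsAcyclic.phiG_mul_one_sub (hE : IsAcyclic E) (hL : ∀ a b, (a, b) ∉ E → L a b = 0)
    (W : Matrix (Fin p) (Fin p) ℝ) : phiG W L * (1 - L) = ((1 - L)⁻¹)ᵀ * W := by
  rw [phiG, Matrix.mul_assoc, Matrix.nonsing_inv_mul _ (hE.isUnit_one_sub hL), Matrix.mul_one]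

theorem phiG_diagonal_apply (ω : Fin p → ℝ) (i j : Fin p) :
    phiG (Matrix.diagonal ω) L i j = ∑ a, (1 - L)⁻¹ a i * ω a * (1 - L)⁻¹ a j := by
  rw [phiG, Matrix.mul_apply]
  simp only [Matrix.mul_diagonal, Matrix.transpose_apply]

theorem IsAcyclic.posDef_phiG (hE : IsAcyclic E) (hL : ∀ a b, (a, b) ∉ E → L a b = 0)
    {ω : Fin p → ℝ} (hω : ∀ v, 0 < ω v) : (phiG (Matrix.diagonal ω) L).PosDef := by
  have h : IsUnit (1 - L)⁻¹ := by
    rw [Matrix.isUnit_nonsing_inv_iff, Matrix.isUnit_iff_isUnit_det]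
    exact hE.isUnit_one_sub hL
  simpa [phiG, Matrix.conjTranspose_eq_transpose_of_trivial] using
    (Matrix.PosDef.diagonal hω).conjTranspose_mul_mul_same (Matrix.mulVec_injective_of_isUnit h)

theorem IsAcyclic.sum_phiG_mul (hE : IsAcyclic E) (hL : ∀ a b, (a, b) ∉ E → L a b = 0)
    (ω : Fin p → ℝ) (k j : Fin p) :
    ∑ a : {a // (a, j) ∈ E}, phiG (Matrix.diagonal ω) L k a * L a j =
      phiG (Matrix.diagonal ω) L k j - (1 - L)⁻¹ j k * ω j := by
  have h := congrFun₂ (hE.phiG_mul_one_sub hL (Matrix.diagonal ω)) k j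
  rw [mul_sub, mul_one, Matrix.sub_apply, Matrix.mul_diagonal, Matrix.transpose_apply,
    Matrix.mul_apply] at h
  rw [← h, sub_sub_cancel, ← Finset.sum_subtype (parents E j) (by simp [parents])
    fun a => phiG (Matrix.diagonal ω) L k a * L a j]
  refine Finset.sum_subset (Finset.subset_univ _) fun a _ ha => ?_
  rw [hL a j (by simpa [parents] using ha), mul_zero]

end Support

/-- The coefficients of the regression of the variable `j` on its parents, under the
covariance matrix `S`. -/
noncomputable def regressionCoeff {p : ℕ} (E : Finset (Fin p × Fin p)) (j : Fin p)
    (S : Matrix (Fin p) (Fin p) ℝ) : {a // (a, j) ∈ E} → ℝ :=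
  (S.submatrix (fun a : {a // (a, j) ∈ E} => a.1) (fun a : {a // (a, j) ∈ E} => a.1))⁻¹ *ᵥ
    fun a : {a // (a, j) ∈ E} => S a j

/-- The residual variance of the regression of the variable `j` on its parents. -/
noncomputable def residualVariance {p : ℕ} (E : Finset (Fin p × Fin p)) (j : Fin p)
    (S : Matrix (Fin p) (Fin p) ℝ) : ℝ :=
  S j j - ∑ a : {a // (a, j) ∈ E}, S j a * regressionCoeff E j S a

section Regression

variable {p : ℕ} {E : Finset (Fin p × Fin p)} {L : Matrix (Fin p) (Fin p) ℝ} {ω : Fin p → ℝ}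

theorem det_submatrix_parents_ne_zero {S : Matrix (Fin p) (Fin p) ℝ} (hS : S.PosDef)
    (j : Fin p) : (S.submatrix (fun a : {a // (a, j) ∈ E} => a.1)
      (fun a : {a // (a, j) ∈ E} => a.1)).det ≠ 0 :=
  (hS.submatrix Subtype.val_injective).det_pos.ne'

theorem IsAcyclic.regressionCoeff_phiG (hE : IsAcyclic E)
    (hL : ∀ a b, (a, b) ∉ E → L a b = 0) (hω : ∀ v, 0 < ω v) (j : Fin p) :
    regressionCoeff E j (phiG (Matrix.diagonal ω) L) = fun a : {a // (a, j) ∈ E} => L a j := by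
  have hdet := (det_submatrix_parents_ne_zero (E := E) (hE.posDef_phiG hL hω) j).isUnit
  have h : (fun a : {a // (a, j) ∈ E} => phiG (Matrix.diagonal ω) L a j) =
      (phiG (Matrix.diagonal ω) L).submatrix (fun a : {a // (a, j) ∈ E} => a.1)
        (fun a : {a // (a, j) ∈ E} => a.1) *ᵥ fun a : {a // (a, j) ∈ E} => L a j := by
    ext k
    simp only [Matrix.mulVec, dotProduct, Matrix.submatrix_apply]
    rw [hE.sum_phiG_mul hL, hE.inv_one_sub_eq_zero hL (hE.ancestorCount_lt k.2), zero_mul,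
      sub_zero]
  rw [regressionCoeff, h, Matrix.mulVec_mulVec, Matrix.nonsing_inv_mul _ hdet,
    Matrix.one_mulVec]

theorem IsAcyclic.residualVariance_phiG (hE : IsAcyclic E)
    (hL : ∀ a b, (a, b) ∉ E → L a b = 0) (hω : ∀ v, 0 < ω v) (j : Fin p) :
    residualVariance E j (phiG (Matrix.diagonal ω) L) = ω j := by
  simp only [residualVariance, hE.regressionCoeff_phiG hL hω, hE.sum_phiG_mul hL,
    hE.inv_one_sub_diag hL, one_mul, sub_sub_cancel]

theorem contDiffAt_regressionCoeff {k : WithTop ℕ∞} {f : Fin p → Fin p → ℝ}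
    (hf : (Matrix.of f).PosDef) (j : Fin p) (a : {a // (a, j) ∈ E}) :
    ContDiffAt ℝ k (fun g : Fin p → Fin p → ℝ => regressionCoeff E j (Matrix.of g) a) f := by
  simp only [regressionCoeff, Matrix.mulVec, dotProduct, Matrix.of_apply]
  refine ContDiffAt.sum fun b _ => ContDiffAt.mul ?_ (by fun_prop)
  refine Matrix.contDiffAt_inv_apply (M := fun g : Fin p → Fin p → ℝ =>
    (Matrix.of g).submatrix (fun a : {a // (a, j) ∈ E} => a.1)
      (fun a : {a // (a, j) ∈ E} => a.1)) (fun c d => ?_)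
    (det_submatrix_parents_ne_zero hf j) a b
  simp only [Matrix.submatrix_apply, Matrix.of_apply]
  fun_prop

theorem contDiffAt_residualVariance {k : WithTop ℕ∞} {f : Fin p → Fin p → ℝ}
    (hf : (Matrix.of f).PosDef) (j : Fin p) :
    ContDiffAt ℝ k (fun g : Fin p → Fin p → ℝ => residualVariance E j (Matrix.of g)) f := by
  simp only [residualVariance, Matrix.of_apply]
  refine ContDiffAt.sub (by fun_prop) (ContDiffAt.sum fun a _ => ContDiffAt.mul (by fun_prop) ?_)
  exact contDiffAt_regressionCoeff hf j a

end Regression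

section Colored

variable {p : ℕ} (E : Finset (Fin p × Fin p)) (cV : Fin p → ℕ) (cE : Fin p × Fin p → ℕ)

/-- A vertex in a given vertex color class. -/
noncomputable def vertexRep (c : {y // y ∈ Finset.univ.image cV}) : Fin p :=
  (Finset.mem_image.1 c.2).choose

theorem color_vertexRep (c : {y // y ∈ Finset.univ.image cV}) : cV (vertexRep cV c) = c :=
  (Finset.mem_image.1 c.2).choose_spec.2

/-- An edge in a given edge color class. -/
noncomputable def edgeRep (c : {y // y ∈ E.image cE}) : Fin p × Fin p :=
  (Finset.mem_image.1 c.2).choose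

theorem edgeRep_mem (c : {y // y ∈ E.image cE}) : edgeRep E cE c ∈ E :=
  (Finset.mem_image.1 c.2).choose_spec.1

theorem color_edgeRep (c : {y // y ∈ E.image cE}) : cE (edgeRep E cE c) = c :=
  (Finset.mem_image.1 c.2).choose_spec.2

/-- The error variances assigned to the vertices by a vector of base parameters. -/
def baseVariance (w : {y // y ∈ Finset.univ.image cV} → ℝ) (v : Fin p) : ℝ :=
  w ⟨cV v, Finset.mem_image_of_mem cV (Finset.mem_univ v)⟩

/-- The edge weights assigned by a vector of base parameters. -/
def baseWeight (l : {y // y ∈ E.image cE} → ℝ) : Matrix (Fin p) (Fin p) ℝ :=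
  Matrix.of fun a b =>
    if h : (a, b) ∈ E then l ⟨cE (a, b), Finset.mem_image_of_mem cE h⟩ else 0

variable {E cV cE}

theorem psiMap_eq (x : ({y // y ∈ Finset.univ.image cV} → ℝ) × ({y // y ∈ E.image cE} → ℝ)) :
    Matrix.of (psiMap E cV cE x) =
      phiG (Matrix.diagonal (baseVariance cV x.1)) (baseWeight E cE x.2) :=
  rfl

theorem baseWeight_eq_zero (l : {y // y ∈ E.image cE} → ℝ) (a b : Fin p) (h : (a, b) ∉ E) :
    baseWeight E cE l a b = 0 := by
  simp [baseWeight, h]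

theorem baseWeight_apply (l : {y // y ∈ E.image cE} → ℝ) {e : Fin p × Fin p} (h : e ∈ E) :
    baseWeight E cE l e.1 e.2 = l ⟨cE e, Finset.mem_image_of_mem cE h⟩ := by
  simp [baseWeight, h]

theorem baseVariance_vertexRep (w : {y // y ∈ Finset.univ.image cV} → ℝ)
    (c : {y // y ∈ Finset.univ.image cV}) : baseVariance cV w (vertexRep cV c) = w c :=
  congrArg w (Subtype.ext (color_vertexRep cV c))

theorem baseWeight_edgeRep (l : {y // y ∈ E.image cE} → ℝ) (c : {y // y ∈ E.image cE}) :
    baseWeight E cE l (edgeRep E cE c).1 (edgeRep E cE c).2 = l c := by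
  rw [baseWeight_apply l (edgeRep_mem E cE c)]
  exact congrArg l (Subtype.ext (color_edgeRep E cE c))

variable (E cV cE) in
/-- Recovers the base parameters from the covariance matrix by regressing on parents. -/
noncomputable def baseParam (f : Fin p → Fin p → ℝ) :
    ({y // y ∈ Finset.univ.image cV} → ℝ) × ({y // y ∈ E.image cE} → ℝ) :=
  (fun c => residualVariance E (vertexRep cV c) (Matrix.of f),
   fun c => regressionCoeff E (edgeRep E cE c).2 (Matrix.of f)
    ⟨(edgeRep E cE c).1, edgeRep_mem E cE c⟩)

theorem contDiffAt_baseParam {k : WithTop ℕ∞} {f : Fin p → Fin p → ℝ}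
    (hf : (Matrix.of f).PosDef) : ContDiffAt ℝ k (baseParam E cV cE) f :=
  (contDiffAt_pi.2 fun _ => contDiffAt_residualVariance hf _).prodMk
    (contDiffAt_pi.2 fun _ => contDiffAt_regressionCoeff hf _ _)

variable {x : ({y // y ∈ Finset.univ.image cV} → ℝ) × ({y // y ∈ E.image cE} → ℝ)}

theorem IsAcyclic.posDef_psiMap (hE : IsAcyclic E) (hx : ∀ c, 0 < x.1 c) :
    (Matrix.of (psiMap E cV cE x)).PosDef :=
  hE.posDef_phiG (baseWeight_eq_zero x.2) fun _ => hx _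

theorem IsAcyclic.baseParam_psiMap (hE : IsAcyclic E) (hx : ∀ c, 0 < x.1 c) :
    baseParam E cV cE (psiMap E cV cE x) = x := by
  have hω : ∀ v, 0 < baseVariance cV x.1 v := fun _ => hx _
  ext c
  · simp only [baseParam, psiMap_eq]
    rw [hE.residualVariance_phiG (baseWeight_eq_zero x.2) hω, baseVariance_vertexRep]
  · simp only [baseParam, psiMap_eq]
    rw [hE.regressionCoeff_phiG (baseWeight_eq_zero x.2) hω]
    exact baseWeight_edgeRep x.2 c

theorem contDiff_baseWeight_apply {k : WithTop ℕ∞} (a b : Fin p) :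
    ContDiff ℝ k fun l : {y // y ∈ E.image cE} → ℝ => baseWeight E cE l a b := by
  simp only [baseWeight, Matrix.of_apply]
  split_ifs
  · exact contDiff_apply ℝ ℝ _
  · exact contDiff_const

theorem IsAcyclic.contDiff_inv_one_sub_baseWeight (hE : IsAcyclic E) {k : WithTop ℕ∞}
    (a b : Fin p) :
    ContDiff ℝ k fun l : {y // y ∈ E.image cE} → ℝ => (1 - baseWeight E cE l)⁻¹ a b :=
  contDiff_iff_contDiffAt.2 fun l => Matrix.contDiffAt_inv_apply
    (M := fun l : {y // y ∈ E.image cE} → ℝ => 1 - baseWeight E cE l)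
    (fun i j => contDiffAt_const.sub (contDiff_baseWeight_apply i j).contDiffAt)
    (hE.isUnit_one_sub (baseWeight_eq_zero l)).ne_zero a b

theorem IsAcyclic.contDiff_psiMap (hE : IsAcyclic E) {k : WithTop ℕ∞} :
    ContDiff ℝ k (psiMap E cV cE) := by
  refine contDiff_pi.2 fun i => contDiff_pi.2 fun j => ?_
  have h (y : ({y // y ∈ Finset.univ.image cV} → ℝ) × ({y // y ∈ E.image cE} → ℝ)) :
      psiMap E cV cE y i j = ∑ a, (1 - baseWeight E cE y.2)⁻¹ a i * baseVariance cV y.1 a *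
        (1 - baseWeight E cE y.2)⁻¹ a j := phiG_diagonal_apply _ i j
  simp only [h]
  refine ContDiff.sum fun a _ => ContDiff.mul (ContDiff.mul ?_ ?_) ?_
  · exact (hE.contDiff_inv_one_sub_baseWeight a i).comp contDiff_snd
  · exact (contDiff_apply ℝ ℝ _).comp contDiff_fst
  · exact (hE.contDiff_inv_one_sub_baseWeight a j).comp contDiff_snd

theorem image_psiMap : psiMap E cV cE '' {x | ∀ c, 0 < x.1 c} =
    {f | Matrix.of f ∈ coloredModel E cV cE} := by
  ext f
  constructor
  · rintro ⟨x, hx, rfl⟩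
    refine ⟨baseVariance cV x.1, baseWeight E cE x.2, fun _ => hx _, baseWeight_eq_zero x.2,
      fun a b h => congrArg x.1 (Subtype.ext h), fun e he e' he' h => ?_, rfl⟩
    rw [baseWeight_apply x.2 he, baseWeight_apply x.2 he']
    exact congrArg x.2 (Subtype.ext h)
  · rintro ⟨ω, L, hω, hL, hcV, hcE, hf⟩
    refine ⟨(fun c => ω (vertexRep cV c), fun c => L (edgeRep E cE c).1 (edgeRep E cE c).2),
      fun _ => hω _, ?_⟩
    apply Matrix.of.injective
    rw [hf, psiMap_eq]
    congr 2
    · ext v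
      exact hcV _ _ (color_vertexRep cV _)
    · ext a b
      by_cases h : (a, b) ∈ E
      · rw [baseWeight_apply (e := (a, b)) _ h]
        exact hcE _ (edgeRep_mem E cE _) _ h (color_edgeRep E cE _)
      · rw [baseWeight_eq_zero _ a b h, hL a b h]

end Colored

/-- Smoothness of colored Gaussian DAG models.
On the open domain `D` of base parameter vectors whose `ω`-coordinates are positive,
the parametrization `ψ` is infinitely differentiable, injective, has injective total
derivative at every point, is a topological embedding (a homeomorphism onto its image),
its image is exactly the colored model `M(G,c)`, and this image consists of positive
definite matrices.  In particular `M(G,c)` is a smooth embedded submanifold of the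
positive definite cone of dimension `vc + ec`. -/
theorem colored_model_smooth {p : ℕ} (E : Finset (Fin p × Fin p)) (hE : IsAcyclic E)
    (cV : Fin p → ℕ) (cE : Fin p × Fin p → ℕ)
    (D : Set (({y // y ∈ Finset.univ.image cV} → ℝ) × ({y // y ∈ E.image cE} → ℝ)))
    (hD : D = {x | ∀ c, 0 < x.1 c}) :
    ContDiffOn ℝ (⊤ : ℕ∞) (psiMap E cV cE) D ∧
    Set.InjOn (psiMap E cV cE) D ∧
    (∀ x ∈ D, Function.Injective (fderiv ℝ (psiMap E cV cE) x)) ∧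
    Topology.IsEmbedding (fun x : D => psiMap E cV cE x.1) ∧
    psiMap E cV cE '' D = {f | Matrix.of f ∈ coloredModel E cV cE} ∧
    (∀ x ∈ D, (Matrix.of (psiMap E cV cE x)).PosDef) := by
  subst hD
  have hleft : Set.LeftInvOn (baseParam E cV cE) (psiMap E cV cE) {x | ∀ c, 0 < x.1 c} :=
    fun x hx => hE.baseParam_psiMap hx
  have hopen : IsOpen {x : ({y // y ∈ Finset.univ.image cV} → ℝ) ×
      ({y // y ∈ E.image cE} → ℝ) | ∀ c, 0 < x.1 c} := by
    simp only [Set.ofPred_forall]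
    exact isOpen_iInter_of_finite fun c => isOpen_lt continuous_const (by fun_prop)
  refine ⟨hE.contDiff_psiMap.contDiffOn, hleft.injOn, fun x hx => ?_, ?_, image_psiMap,
    fun x hx => hE.posDef_psiMap hx⟩
  · have hψ : HasFDerivAt (psiMap E cV cE) (fderiv ℝ (psiMap E cV cE) x) x :=
      (hE.contDiff_psiMap.differentiable one_ne_zero x).hasFDerivAt
    have hg : HasFDerivAt (baseParam E cV cE) (fderiv ℝ (baseParam E cV cE) _)
        (psiMap E cV cE x) :=
      ((contDiffAt_baseParam (hE.posDef_psiMap hx)).differentiableAt one_ne_zero).hasFDerivAt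
    have hid := (hasFDerivAt_id (𝕜 := ℝ) x).congr_of_eventuallyEq
      (f₁ := baseParam E cV cE ∘ psiMap E cV cE)
      (Filter.eventuallyEq_of_mem (hopen.mem_nhds hx) hleft)
    have h := (hg.comp x hψ).unique hid
    exact Function.LeftInverse.injective (g := fderiv ℝ (baseParam E cV cE) (psiMap E cV cE x))
      fun v => DFunLike.congr_fun h v
  · refine ⟨Topology.isInducing_iff_nhds.2 fun x => le_antisymm ?_ ?_, hleft.injOn.injective⟩
    · exact Filter.map_le_iff_le_comap.1 ((hE.contDiff_psiMap (k := 0)).continuous.comp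
        continuous_subtype_val).continuousAt
    · have hg := (contDiffAt_baseParam (k := 0) (E := E) (cV := cV) (cE := cE)
        (hE.posDef_psiMap x.2)).continuousAt.tendsto
      rw [hE.baseParam_psiMap x.2] at hg
      rw [nhds_subtype, ← Filter.map_le_iff_le_comap]
      exact (hg.comp Filter.tendsto_comap).congr fun y => hleft y.2
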